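/- For every integer l ≥ 0, every integer k with |k| ≤ l, and every rotation R ∈ SO(3), the rotated real spherical harmonic Ω ↦ Y_l^k(RΩ) lies in the linear span of the real spherical harmonics of the same degree l; moreover Y_l^k(RΩ) = Σ_{k'=−l}^{l} D^l_{k,k'} Y_l^{k'}(Ω) for all Ω ∈ S², where D^l_{k,k'} = ∫_{S²} Y_l^k(RΩ') Y_l^{k'}(Ω') dΩ'. -/

import Mathlib

open MeasureTheory Real Set intervalIntegral

/-- Legendre polynomial `P_l(x) = (1/(2^l l!)) (d/dx)^l (x²-1)^l` (Rodrigues formula). -/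
noncomputable def legendreP (l : ℕ) (x : ℝ) : ℝ :=
  (1 / ((2 : ℝ) ^ l * (Nat.factorial l : ℝ))) *
    iteratedDeriv l (fun y : ℝ => (y ^ 2 - 1) ^ l) x

/-- Associated Legendre function `P_l^m(x) = (1-x²)^{m/2} (d/dx)^m P_l(x)`. -/
noncomputable def assocLegendre (l m : ℕ) (x : ℝ) : ℝ :=
  (1 - x ^ 2) ^ ((m : ℝ) / 2) * iteratedDeriv m (legendreP l) x

/-- Real spherical harmonic `Y_l^k` of degree `l` and order `k`, expressed in the spherical
coordinates `Ω(μ,φ)`: `Y_l^k(Ω(μ,φ)) = C_{l,|k|} P_l^{|k|}(μ) t_k(φ)`. -/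
noncomputable def sphHarm (l : ℕ) (k : ℤ) (μ φ : ℝ) : ℝ :=
  ((-1 : ℝ) ^ k.natAbs *
      Real.sqrt ((2 * (l : ℝ) + 1) / (2 * Real.pi) *
        ((Nat.factorial (l - k.natAbs) : ℝ) / (Nat.factorial (l + k.natAbs) : ℝ)))) *
    assocLegendre l k.natAbs μ *
    (if 0 < k then Real.cos ((k.natAbs : ℝ) * φ)
     else if k = 0 then 1 / Real.sqrt 2
     else Real.sin ((k.natAbs : ℝ) * φ))

/-- The point `Ω(μ,φ) = (√(1-μ²) cos φ, √(1-μ²) sin φ, μ)` of the unit sphere. -/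
noncomputable def dirVec (μ φ : ℝ) : Fin 3 → ℝ :=
  ![Real.sqrt (1 - μ ^ 2) * Real.cos φ, Real.sqrt (1 - μ ^ 2) * Real.sin φ, μ]

/-- The real spherical harmonic `Y_l^k` as a function of a point of the unit sphere,
written in Cartesian coordinates (`μ` is the third coordinate and `φ` the azimuthal angle
of the first two coordinates); on the sphere `sphHarmVec l k (dirVec μ φ) = sphHarm l k μ φ`. -/
noncomputable def sphHarmVec (l : ℕ) (k : ℤ) (v : Fin 3 → ℝ) : ℝ :=
  sphHarm l k (v 2) (Complex.arg ⟨v 0, v 1⟩)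

section

open Polynomial

/-- The coefficients of the `l`-th power of the quadratic polynomial `a X² + b X + c`. -/
noncomputable def trinomialCoeff {K : Type*} [CommRing K] (a b c : K) (l n : ℕ) : K :=
  ((C a * X ^ 2 + C b * X + C c) ^ l).coeff n

theorem natDegree_trinomial_pow_le {K : Type*} [CommRing K] (a b c : K) (l : ℕ) :
    ((C a * X ^ 2 + C b * X + C c) ^ l).natDegree ≤ 2 * l := by
  have h : (C a * X ^ 2 + C b * X + C c).natDegree ≤ 2 := by compute_degree
  exact natDegree_pow_le.trans (by nlinarith)

theorem trinomialCoeff_eq_zero {K : Type*} [CommRing K] (a b c : K) {l n : ℕ} (hn : 2 * l < n) :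
    trinomialCoeff a b c l n = 0 :=
  coeff_eq_zero_of_natDegree_lt ((natDegree_trinomial_pow_le a b c l).trans_lt hn)

theorem trinomialCoeff_two_mul {K : Type*} [CommRing K] (a b c : K) (l : ℕ) :
    trinomialCoeff a b c l (2 * l) = a ^ l := by
  rw [trinomialCoeff, mul_comm 2 l, coeff_pow_of_natDegree_le (by compute_degree)]
  simp

theorem sum_trinomialCoeff_mul_pow {K : Type*} [CommRing K] (a b c s : K) (l : ℕ) :
    (a * s ^ 2 + b * s + c) ^ l =
      ∑ n ∈ Finset.range (2 * l + 1), trinomialCoeff a b c l n * s ^ n := by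
  have h := eval_eq_sum_range' (Nat.lt_succ_of_le (natDegree_trinomial_pow_le a b c l)) s
  simpa [trinomialCoeff] using h

/-- The homogeneous form of the expansion of the power of a quadratic polynomial. -/
theorem sum_trinomialCoeff_mul_pow_mul_pow {K : Type*} [Field K] (a b c s t : K) (l : ℕ) :
    (a * s ^ 2 + b * (s * t) + c * t ^ 2) ^ l =
      ∑ n ∈ Finset.range (2 * l + 1), trinomialCoeff a b c l n * (s ^ n * t ^ (2 * l - n)) := by
  by_cases ht : t = 0
  · subst ht
    rw [Finset.sum_range_succ, Finset.sum_eq_zero]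
    · rw [trinomialCoeff_two_mul]
      simp [mul_pow, ← pow_mul]
    · intro n hn
      have : 2 * l - n ≠ 0 := by have := Finset.mem_range.1 hn; omega
      simp [this]
  · have h := sum_trinomialCoeff_mul_pow a b c (s / t) l
    have e : a * s ^ 2 + b * (s * t) + c * t ^ 2 =
        (a * (s / t) ^ 2 + b * (s / t) + c) * t ^ 2 := by field_simp
    rw [e, mul_pow, h, Finset.sum_mul]
    refine Finset.sum_congr rfl fun n hn => ?_
    have hn' : n ≤ 2 * l := by have := Finset.mem_range.1 hn; omega
    rw [← pow_mul, div_pow, mul_assoc]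
    congr 1
    obtain ⟨d, hd⟩ := Nat.exists_eq_add_of_le hn'
    rw [hd, pow_add, Nat.add_sub_cancel_left]
    field_simp

theorem trinomialCoeff_reverse {K : Type*} [Field K] [Infinite K] (a b c : K) {l n : ℕ}
    (hn : n ≤ 2 * l) : trinomialCoeff a b c l (2 * l - n) = trinomialCoeff c b a l n := by
  have key : (C c * X ^ 2 + C b * X + C a) ^ l =
      ∑ n ∈ Finset.range (2 * l + 1), C (trinomialCoeff a b c l (2 * l - n)) * X ^ n := by
    refine Polynomial.funext fun t => ?_
    have h := sum_trinomialCoeff_mul_pow_mul_pow a b c 1 t l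
    rw [← Finset.sum_range_reflect] at h
    simp only [eval_pow, eval_add, eval_mul, eval_C, eval_X, eval_finsetSum]
    rw [show c * t ^ 2 + b * t + a = a * 1 ^ 2 + b * (1 * t) + c * t ^ 2 by ring, h]
    refine Finset.sum_congr rfl fun n hn => ?_
    have hn' : n ≤ 2 * l := by have := Finset.mem_range.1 hn; omega
    rw [show 2 * l + 1 - 1 - n = 2 * l - n by omega, Nat.sub_sub_self hn']
    simp
  have := congrArg (fun p => p.coeff n) key
  simp only [finsetSum_coeff, coeff_C_mul, coeff_X_pow, mul_ite, mul_one, mul_zero] at this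
  rw [Finset.sum_ite_eq, if_pos (Finset.mem_range.2 (by omega))] at this
  exact this.symm

theorem trinomialCoeff_mul_pow {K : Type*} [CommRing K] (a b c s : K) (l n : ℕ) :
    trinomialCoeff (a * s ^ 2) (b * s) c l n = s ^ n * trinomialCoeff a b c l n := by
  have : (C (a * s ^ 2) * X ^ 2 + C (b * s) * X + C c) ^ l =
      ((C a * X ^ 2 + C b * X + C c) ^ l).comp (C s * X) := by
    simp
    ring
  rw [trinomialCoeff, this, comp_C_mul_X_coeff, trinomialCoeff, mul_comm]

theorem trinomialCoeff_smul {K : Type*} [CommRing K] (a b c s : K) (l n : ℕ) :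
    trinomialCoeff (s * a) (s * b) (s * c) l n = s ^ l * trinomialCoeff a b c l n := by
  have : (C (s * a) * X ^ 2 + C (s * b) * X + C (s * c)) ^ l =
      C (s ^ l) * (C a * X ^ 2 + C b * X + C c) ^ l := by
    rw [C_pow, ← mul_pow]
    simp
    ring
  rw [trinomialCoeff, this, coeff_C_mul, trinomialCoeff]

theorem map_trinomialCoeff {K L : Type*} [CommRing K] [CommRing L] (f : K →+* L) (a b c : K)
    (l n : ℕ) : f (trinomialCoeff a b c l n) = trinomialCoeff (f a) (f b) (f c) l n := by
  simp [trinomialCoeff, ← coeff_map, Polynomial.map_pow]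

/-- The Taylor coefficients of `(X² - 1) ^ l`. -/
noncomputable def rodriguesCoeff (l n : ℕ) : ℝ[X] := hasseDeriv n ((X ^ 2 - 1) ^ l)

theorem eval_rodriguesCoeff (l n : ℕ) (x : ℝ) :
    (rodriguesCoeff l n).eval x = trinomialCoeff 1 (2 * x) (x ^ 2 - 1) l n := by
  rw [rodriguesCoeff, ← taylor_coeff, trinomialCoeff]
  congr 1
  simp only [taylor_apply, pow_comp, sub_comp, X_comp, one_comp]
  congr 1
  simp [show C (2 : ℝ) = 2 from rfl]
  ring

theorem factorial_mul_rodriguesCoeff (l n : ℕ) :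
    (n.factorial : ℝ[X]) * rodriguesCoeff l n = derivative^[n] ((X ^ 2 - 1) ^ l) := by
  rw [← factorial_smul_hasseDeriv, rodriguesCoeff]
  simp

theorem eval_rodriguesCoeff_reflect {l m : ℕ} (hm : m ≤ l) (x : ℝ) :
    (rodriguesCoeff l (l - m)).eval x =
      (-1) ^ m * (1 - x ^ 2) ^ m * (rodriguesCoeff l (l + m)).eval x := by
  have key : (X ^ 2 - 1) ^ (l + m) * rodriguesCoeff l (l - m) =
      (X ^ 2 - 1) ^ (l + m) * ((X ^ 2 - 1) ^ m * rodriguesCoeff l (l + m)) := by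
    refine Polynomial.funext fun t => ?_
    simp only [eval_mul, eval_pow, eval_sub, eval_X, eval_one, eval_rodriguesCoeff]
    have h1 := trinomialCoeff_mul_pow (1 : ℝ) (2 * t) (t ^ 2 - 1) (t ^ 2 - 1) l (l + m)
    have h2 := trinomialCoeff_smul (t ^ 2 - 1) (2 * t) 1 (t ^ 2 - 1) l (l + m)
    have h3 := trinomialCoeff_reverse (t ^ 2 - 1) (2 * t) 1 (l := l) (n := l - m) (by omega)
    rw [show 2 * l - (l - m) = l + m by omega] at h3
    rw [← h3]
    have e : trinomialCoeff (1 * (t ^ 2 - 1) ^ 2) (2 * t * (t ^ 2 - 1)) (t ^ 2 - 1) l (l + m) =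
      trinomialCoeff ((t ^ 2 - 1) * (t ^ 2 - 1)) ((t ^ 2 - 1) * (2 * t)) ((t ^ 2 - 1) * 1) l
        (l + m) := by congr 1 <;> ring
    rw [h1, h2] at e
    linear_combination (-(t ^ 2 - 1) ^ m) * e
  have hne : ((X ^ 2 - 1 : ℝ[X]) ^ (l + m)) ≠ 0 :=
    pow_ne_zero _ (Polynomial.Monic.ne_zero (by monicity!))
  have := congrArg (eval x) (mul_left_cancel₀ hne key)
  rw [this]
  simp only [eval_mul, eval_pow, eval_sub, eval_X, eval_one]
  rw [← mul_pow]
  ring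

end

/-- If a vector-valued polynomial takes values in a subspace at every point, its coefficients
belong to that subspace. -/
theorem Submodule.mem_of_forall_sum_pow_smul_mem {K V : Type*} [Field K] [Infinite K]
    [AddCommGroup V] [Module K V] (S : Submodule K V) {N : ℕ} {w : ℕ → V}
    (h : ∀ t : K, ∑ n ∈ Finset.range N, t ^ n • w n ∈ S) {n : ℕ} (hn : n < N) : w n ∈ S := by
  by_contra hw
  obtain ⟨f, hf, hS⟩ := Submodule.exists_le_ker_of_notMem hw
  have hp : ∑ i ∈ Finset.range N, Polynomial.C (f (w i)) * Polynomial.X ^ i = 0 := by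
    refine Polynomial.funext fun t => ?_
    have := LinearMap.mem_ker.1 (hS (h t))
    simp only [map_sum, map_smul, smul_eq_mul] at this
    simp only [Polynomial.eval_finsetSum, Polynomial.eval_mul, Polynomial.eval_C,
      Polynomial.eval_pow, Polynomial.eval_X, Polynomial.eval_zero]
    rw [← this]
    exact Finset.sum_congr rfl fun i _ => mul_comm _ _
  have := congrArg (fun p => Polynomial.coeff p n) hp
  simp only [Polynomial.finsetSum_coeff, Polynomial.coeff_C_mul, Polynomial.coeff_X_pow, mul_ite,
    mul_one, mul_zero, Polynomial.coeff_zero] at this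
  rw [Finset.sum_ite_eq, if_pos (Finset.mem_range.2 hn)] at this
  exact hf this

/-- The harmonic polynomials of degree `l` generated by the powers of isotropic linear forms:
`((x + iy) t² + 2 z t - (x - iy)) ^ l = ∑ n, isotropicCoeff l n (x, y, z) * t ^ n`. -/
noncomputable def isotropicCoeff (l n : ℕ) (v : Fin 3 → ℝ) : ℂ :=
  trinomialCoeff ((v 0 : ℂ) + v 1 * Complex.I) (2 * (v 2 : ℂ)) (-((v 0 : ℂ) - v 1 * Complex.I)) l n

theorem isotropicCoeff_eq_zero {l n : ℕ} (hn : 2 * l < n) : isotropicCoeff l n = 0 :=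
  funext fun _ => trinomialCoeff_eq_zero _ _ _ hn

/-- The power of a linear form whose coefficient vector is isotropic is a combination of the
functions `isotropicCoeff l n`. -/
theorem isotropic_pow_mem_span (l : ℕ) (β : Fin 3 → ℂ) (hβ : β 0 ^ 2 + β 1 ^ 2 + β 2 ^ 2 = 0) :
    (fun v : Fin 3 → ℝ => (β 0 * v 0 + β 1 * v 1 + β 2 * v 2) ^ l) ∈
      Submodule.span ℂ (Set.range (isotropicCoeff l)) := by
  obtain ⟨s, t, hs, ht, hst⟩ : ∃ s t : ℂ, s ^ 2 = (β 0 - Complex.I * β 1) / 2 ∧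
      t ^ 2 = -((β 0 + Complex.I * β 1) / 2) ∧ 2 * (s * t) = β 2 := by
    obtain ⟨s, hs⟩ := IsAlgClosed.exists_pow_nat_eq ((β 0 - Complex.I * β 1) / 2) two_pos
    have hprod : 4 * s ^ 2 * ((β 0 + Complex.I * β 1) / 2) = - β 2 ^ 2 := by
      linear_combination 2 * (β 0 + Complex.I * β 1) * hs + hβ - β 1 ^ 2 * Complex.I_sq
    by_cases h0 : s = 0
    · obtain ⟨t, ht⟩ :=
        IsAlgClosed.exists_pow_nat_eq (-((β 0 + Complex.I * β 1) / 2)) two_pos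
      refine ⟨s, t, hs, ht, ?_⟩
      have : β 2 = 0 := by
        have : β 2 ^ 2 = 0 := by
          linear_combination hprod - 2 * s * (β 0 + Complex.I * β 1) * h0
        exact pow_eq_zero_iff two_ne_zero |>.1 this
      rw [h0, this]
      ring
    · refine ⟨s, β 2 / (2 * s), hs, ?_, by field_simp⟩
      field_simp
      linear_combination hprod
  have : (fun v : Fin 3 → ℝ => (β 0 * v 0 + β 1 * v 1 + β 2 * v 2) ^ l) =
      ∑ n ∈ Finset.range (2 * l + 1), (s ^ n * t ^ (2 * l - n)) • isotropicCoeff l n := by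
    funext v
    simp only [Finset.sum_apply, Pi.smul_apply, smul_eq_mul, isotropicCoeff]
    simp_rw [mul_comm (s ^ _ * t ^ _)]
    rw [← sum_trinomialCoeff_mul_pow_mul_pow]
    congr 1
    linear_combination (-(v 0 + v 1 * Complex.I : ℂ)) * hs + (v 0 - v 1 * Complex.I : ℂ) * ht -
      (v 2 : ℂ) * hst + β 1 * v 1 * Complex.I_sq
  rw [this]
  exact Submodule.sum_mem _ fun n _ =>
    Submodule.smul_mem _ _ (Submodule.subset_span (Set.mem_range_self n))

theorem isotropicCoeff_mulVec_mem_span (l n : ℕ) {R : Matrix (Fin 3) (Fin 3) ℝ}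
    (hR : R * R.transpose = 1) :
    (fun v => isotropicCoeff l n (R.mulVec v)) ∈
      Submodule.span ℂ (Set.range (isotropicCoeff l)) := by
  rcases lt_or_ge (2 * l) n with hn | hn
  · rw [isotropicCoeff_eq_zero hn]
    exact Submodule.zero_mem _
  refine Submodule.mem_of_forall_sum_pow_smul_mem (N := 2 * l + 1) _
    (w := fun n v => isotropicCoeff l n (R.mulVec v)) (fun t => ?_) (Nat.lt_succ_of_le hn)
  have hRR : ∀ i j,
      (R i 0 : ℂ) * R j 0 + R i 1 * R j 1 + R i 2 * R j 2 = if i = j then 1 else 0 := by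
    intro i j
    have := congrFun (congrFun hR i) j
    simp only [Matrix.mul_apply, Fin.sum_univ_three, Matrix.transpose_apply,
      Matrix.one_apply] at this
    have := congrArg Complex.ofReal this
    push_cast at this
    rw [this]
    split_ifs <;> simp
  have h00 := hRR 0 0
  have h01 := hRR 0 1
  have h02 := hRR 0 2
  have h11 := hRR 1 1
  have h12 := hRR 1 2
  have h22 := hRR 2 2
  simp only [Fin.isValue, ↓reduceIte, Fin.reduceEq] at h00 h01 h02 h11 h12 h22
  have := isotropic_pow_mem_span l
    (fun j => (t ^ 2 - 1) * R 0 j + Complex.I * (t ^ 2 + 1) * R 1 j + 2 * t * R 2 j) (by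
      linear_combination (t ^ 2 - 1) ^ 2 * h00 + Complex.I ^ 2 * (t ^ 2 + 1) ^ 2 * h11 +
        4 * t ^ 2 * h22 + 2 * (t ^ 2 - 1) * Complex.I * (t ^ 2 + 1) * h01 +
        4 * (t ^ 2 - 1) * t * h02 + 4 * Complex.I * (t ^ 2 + 1) * t * h12 +
        (t ^ 2 + 1) ^ 2 * Complex.I_sq)
  convert this using 1
  funext v
  simp only [Finset.sum_apply, Pi.smul_apply, smul_eq_mul, isotropicCoeff]
  simp_rw [mul_comm (t ^ _)]
  rw [← sum_trinomialCoeff_mul_pow]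
  congr 1
  simp only [Matrix.mulVec, dotProduct, Fin.sum_univ_three]
  push_cast
  ring

theorem isotropicCoeff_sub {l m : ℕ} (hm : m ≤ l) (v : Fin 3 → ℝ) :
    isotropicCoeff l (l - m) v =
      (-1) ^ m * (starRingEnd ℂ) (isotropicCoeff l (l + m) v) := by
  have h1 := trinomialCoeff_reverse (-((v 0 : ℂ) - v 1 * Complex.I)) (2 * (v 2 : ℂ))
    ((v 0 : ℂ) + v 1 * Complex.I) (l := l) (n := l - m) (by omega)
  rw [show 2 * l - (l - m) = l + m by omega] at h1
  have h2 := trinomialCoeff_mul_pow (((v 0 : ℂ) - v 1 * Complex.I)) (2 * (v 2 : ℂ))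
    (-((v 0 : ℂ) + v 1 * Complex.I)) (-1) l (l + m)
  have h3 := trinomialCoeff_smul (-((v 0 : ℂ) - v 1 * Complex.I)) (2 * (v 2 : ℂ))
    ((v 0 : ℂ) + v 1 * Complex.I) (-1) l (l + m)
  have e : trinomialCoeff (((v 0 : ℂ) - v 1 * Complex.I) * (-1) ^ 2) (2 * (v 2 : ℂ) * -1)
      (-((v 0 : ℂ) + v 1 * Complex.I)) l (l + m) =
      trinomialCoeff (-1 * -((v 0 : ℂ) - v 1 * Complex.I)) (-1 * (2 * (v 2 : ℂ)))
      (-1 * ((v 0 : ℂ) + v 1 * Complex.I)) l (l + m) := by congr 1 <;> ring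
  have hs : ((-1 : ℂ) ^ l) * (-1) ^ l = 1 := by rw [← mul_pow]; norm_num
  rw [isotropicCoeff, isotropicCoeff, map_trinomialCoeff, ← h1]
  simp only [map_add, map_mul, map_neg, map_sub, Complex.conj_ofReal, Complex.conj_I, map_ofNat,
    mul_neg, sub_neg_eq_add, ← sub_eq_add_neg]
  rw [h2, h3, pow_add] at e
  linear_combination (-(-1) ^ l) * e +
    ((-1) ^ m * trinomialCoeff ((v 0 : ℂ) - v 1 * Complex.I) (2 * (v 2 : ℂ))
        (-((v 0 : ℂ) + v 1 * Complex.I)) l (l + m) -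
      trinomialCoeff (-((v 0 : ℂ) - v 1 * Complex.I)) (2 * (v 2 : ℂ))
        ((v 0 : ℂ) + v 1 * Complex.I) l (l + m)) * hs

theorem isotropicCoeff_dirVec {l m : ℕ} {x : ℝ} (hx : x ∈ Icc (-1 : ℝ) 1) (φ : ℝ) :
    isotropicCoeff l (l + m) (dirVec x φ) =
      ((√(1 - x ^ 2) ^ m * (rodriguesCoeff l (l + m)).eval x : ℝ) : ℂ) *
        (Real.cos (m * φ) + Real.sin (m * φ) * Complex.I) := by
  have hs : √(1 - x ^ 2) ^ 2 = 1 - x ^ 2 := Real.sq_sqrt (by nlinarith [hx.1, hx.2])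
  set r := √(1 - x ^ 2) with hr
  set u : ℂ := (r : ℂ) * (Real.cos φ + Real.sin φ * Complex.I) with hu
  have hum : ((r ^ m * (rodriguesCoeff l (l + m)).eval x : ℝ) : ℂ) *
      (Real.cos (m * φ) + Real.sin (m * φ) * Complex.I) =
      u ^ m * trinomialCoeff 1 (2 * (x : ℂ)) ((x : ℂ) ^ 2 - 1) l (l + m) := by
    have := map_trinomialCoeff Complex.ofRealHom 1 (2 * x) (x ^ 2 - 1) l (l + m)
    simp only [Complex.ofRealHom_eq_coe, Complex.ofReal_mul, Complex.ofReal_sub, Complex.ofReal_pow,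
      Complex.ofReal_one, Complex.ofReal_ofNat] at this
    rw [eval_rodriguesCoeff, hu, mul_pow]
    push_cast
    rw [Complex.cos_add_sin_mul_I_pow, this]
    ring
  rw [hum]
  have hc : (Real.cos φ : ℂ) ^ 2 + (Real.sin φ : ℂ) ^ 2 = 1 := by
    exact_mod_cast Real.cos_sq_add_sin_sq φ
  have hs' : (r : ℂ) ^ 2 = 1 - (x : ℂ) ^ 2 := by exact_mod_cast hs
  have h := trinomialCoeff_mul_pow 1 (2 * (x : ℂ)) ((x : ℂ) ^ 2 - 1) u l (l + m)
  have h2 := trinomialCoeff_smul u (2 * (x : ℂ)) (-(r * (Real.cos φ - Real.sin φ * Complex.I)))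
    u l (l + m)
  have e : trinomialCoeff (1 * u ^ 2) (2 * (x : ℂ) * u) ((x : ℂ) ^ 2 - 1) l (l + m) =
      trinomialCoeff (u * u) (u * (2 * (x : ℂ)))
        (u * -(r * (Real.cos φ - Real.sin φ * Complex.I))) l (l + m) := by
    congr 1
    · ring
    · ring
    · rw [hu]
      linear_combination hs' + r ^ 2 * hc - r ^ 2 * (Real.sin φ : ℂ) ^ 2 * Complex.I_sq
  have hF : isotropicCoeff l (l + m) (dirVec x φ) =
      trinomialCoeff u (2 * (x : ℂ)) (-(r * (Real.cos φ - Real.sin φ * Complex.I))) l (l + m) := by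
    simp only [isotropicCoeff, dirVec, Matrix.cons_val_zero, Matrix.cons_val_one,
      Matrix.cons_val, ← hr, hu]
    push_cast
    congr 1 <;> ring
  rw [hF]
  rw [h, h2] at e
  by_cases h0 : u = 0
  · have hr0 : r = 0 := by
      have : ((r : ℂ) ^ 2) = 0 := by
        have : (u * (r * (Real.cos φ - Real.sin φ * Complex.I))) = 0 := by rw [h0]; ring
        rw [hu] at this
        linear_combination this - r ^ 2 * hc + r ^ 2 * (Real.sin φ : ℂ) ^ 2 * Complex.I_sq
      exact_mod_cast pow_eq_zero_iff two_ne_zero |>.1 this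
    have hx1 : (x : ℂ) ^ 2 - 1 = 0 := by rw [← neg_sub, ← hs', hr0]; simp
    rw [h0, hr0, hx1]
    rcases Nat.eq_zero_or_pos m with rfl | hm
    · have e1 : ∀ a b : ℂ, trinomialCoeff a b 0 l l = b ^ l := by
        intro a b
        rw [trinomialCoeff, show Polynomial.C a * Polynomial.X ^ 2 + Polynomial.C b * Polynomial.X +
          Polynomial.C 0 = (Polynomial.C a * Polynomial.X + Polynomial.C b) * Polynomial.X by
            simp; ring, mul_pow]
        rw [Polynomial.coeff_mul_X_pow', if_pos le_rfl, Nat.sub_self,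
          Polynomial.coeff_zero_eq_eval_zero]
        simp
      simp [e1]
    · rw [zero_pow hm.ne']
      rw [trinomialCoeff]
      simp only [Polynomial.C_0, zero_mul, zero_add, Complex.ofReal_zero, neg_zero, add_zero]
      rw [mul_pow, ← Polynomial.C_pow, Polynomial.coeff_C_mul_X_pow, if_neg (by omega)]
  · rw [pow_add] at e
    exact mul_left_cancel₀ (pow_ne_zero l h0) (by linear_combination -e)

section

open Polynomial

theorem Polynomial.iteratedDeriv_eval (p : ℝ[X]) (n : ℕ) :
    iteratedDeriv n (fun x => p.eval x) = fun x => (derivative^[n] p).eval x := by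
  induction n with
  | zero => simp
  | succ n ih =>
    rw [iteratedDeriv_succ, ih]
    funext x
    rw [Function.iterate_succ_apply', Polynomial.deriv]

theorem eval_iterate_derivative_rodrigues (l n : ℕ) (x : ℝ) :
    (derivative^[n] ((X ^ 2 - 1 : ℝ[X]) ^ l)).eval x =
      n.factorial * (rodriguesCoeff l n).eval x := by
  simp [← factorial_mul_rodriguesCoeff]

/-- The colatitude factor of the spherical harmonics, up to normalization. -/
noncomputable def polarFactor (l m : ℕ) (x : ℝ) : ℝ :=
  √(1 - x ^ 2) ^ m * (rodriguesCoeff l (l + m)).eval x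

theorem assocLegendre_eq (l m : ℕ) {x : ℝ} (hx : x ∈ Icc (-1 : ℝ) 1) :
    assocLegendre l m x =
      ((l + m).factorial / (2 ^ l * l.factorial) : ℝ) * polarFactor l m x := by
  have hL : legendreP l = fun x =>
      (C (1 / ((2 : ℝ) ^ l * l.factorial)) * derivative^[l] ((X ^ 2 - 1) ^ l)).eval x := by
    funext x
    have : (fun y : ℝ => (y ^ 2 - 1) ^ l) = fun y => ((X ^ 2 - 1 : ℝ[X]) ^ l).eval y := by simp
    rw [legendreP, this, Polynomial.iteratedDeriv_eval, eval_mul, eval_C]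
  rw [assocLegendre, hL, Polynomial.iteratedDeriv_eval, iterate_derivative_C_mul,
    ← Function.iterate_add_apply]
  dsimp only
  rw [eval_mul, eval_C, eval_iterate_derivative_rodrigues,
    Real.rpow_div_two_eq_sqrt _ (by nlinarith [hx.1, hx.2]), Real.rpow_natCast, polarFactor,
    add_comm m l]
  ring

theorem eval_iterate_derivative_rodrigues_eq_zero {l j : ℕ} (hj : j < l) {x : ℝ}
    (hx : x ^ 2 = 1) : (derivative^[j] ((X ^ 2 - 1 : ℝ[X]) ^ l)).eval x = 0 := by
  obtain ⟨q, hq⟩ := pow_sub_dvd_iterate_derivative_pow (X ^ 2 - 1 : ℝ[X]) l j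
  rw [hq]
  simp [hx, (Nat.sub_pos_of_lt hj).ne']

theorem integral_iterate_derivative_rodrigues_mul {l j : ℕ} (hj : j ≤ l) (g : ℝ[X]) :
    ∫ x in (-1 : ℝ)..1, (derivative^[j] ((X ^ 2 - 1 : ℝ[X]) ^ l)).eval x * g.eval x =
      (-1) ^ j * ∫ x in (-1 : ℝ)..1, ((X ^ 2 - 1 : ℝ[X]) ^ l).eval x * (derivative^[j] g).eval x := by
  induction j generalizing g with
  | zero => simp
  | succ j ih =>
    have h := intervalIntegral.integral_mul_deriv_eq_deriv_mul (a := (-1 : ℝ)) (b := 1)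
      (u := fun x => g.eval x) (u' := fun x => (derivative g).eval x)
      (v := fun x => (derivative^[j] ((X ^ 2 - 1 : ℝ[X]) ^ l)).eval x)
      (v' := fun x => (derivative^[j + 1] ((X ^ 2 - 1 : ℝ[X]) ^ l)).eval x)
      (fun x _ => g.hasDerivAt x)
      (fun x _ => by
        rw [Function.iterate_succ_apply']
        exact Polynomial.hasDerivAt _ x)
      (Polynomial.continuous _).continuousOn.intervalIntegrable
      (Polynomial.continuous _).continuousOn.intervalIntegrable
    simp only [eval_iterate_derivative_rodrigues_eq_zero (Nat.lt_of_succ_le hj) (one_pow 2),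
      eval_iterate_derivative_rodrigues_eq_zero (Nat.lt_of_succ_le hj)
        (show (-1 : ℝ) ^ 2 = 1 by norm_num)] at h
    have ih' := ih (by omega) (derivative g)
    rw [Function.iterate_succ_apply (f := derivative) (n := j) (x := g), pow_succ' (-1 : ℝ) j,
      mul_assoc, neg_one_mul, ← ih']
    refine (intervalIntegral.integral_congr fun x _ => mul_comm _ _).trans (h.trans ?_)
    rw [mul_zero, mul_zero, sub_self, zero_sub]
    exact congrArg Neg.neg (intervalIntegral.integral_congr fun x _ => mul_comm _ _)

theorem integral_one_sub_sq_pow (l : ℕ) :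
    ((2 * l + 1).factorial : ℝ) * ∫ x in (-1 : ℝ)..1, (1 - x ^ 2) ^ l =
      2 ^ (2 * l + 1) * (l.factorial : ℝ) ^ 2 := by
  induction l with
  | zero => norm_num
  | succ l ih =>
    have h : ∫ x in (-1 : ℝ)..1, ((2 * l + 3) * (1 - x ^ 2) ^ (l + 1) -
        (2 * l + 2) * (1 - x ^ 2) ^ l) = 0 := by
      rw [intervalIntegral.integral_eq_sub_of_hasDerivAt
        (f := fun x : ℝ => x * (1 - x ^ 2) ^ (l + 1))]
      · simp
      · intro x _
        have h1 : HasDerivAt (fun x : ℝ => (1 - x ^ 2) ^ (l + 1))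
            ((l + 1) * (1 - x ^ 2) ^ l * -(2 * x)) x := by
          refine (((hasDerivAt_pow 2 x).const_sub 1).fun_pow (l + 1)).congr_deriv ?_
          simp
        refine ((hasDerivAt_id' x).mul h1).congr_deriv ?_
        ring
      · exact Continuous.intervalIntegrable (by fun_prop) _ _
    rw [intervalIntegral.integral_sub (Continuous.intervalIntegrable (by fun_prop) _ _)
      (Continuous.intervalIntegrable (by fun_prop) _ _), intervalIntegral.integral_const_mul,
      intervalIntegral.integral_const_mul] at h
    rw [show 2 * (l + 1) + 1 = 2 * l + 1 + 1 + 1 by ring, Nat.factorial_succ (2 * l + 1 + 1),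
      Nat.factorial_succ (2 * l + 1), Nat.factorial_succ l]
    push_cast
    linear_combination (2 * l + 2) * ((2 * l + 1).factorial : ℝ) * h + (2 * l + 2) ^ 2 * ih

theorem polarFactor_sq {l m : ℕ} (hm : m ≤ l) {x : ℝ} (hx : x ∈ Icc (-1 : ℝ) 1) :
    polarFactor l m x ^ 2 =
      (-1) ^ m * ((rodriguesCoeff l (l - m)).eval x * (rodriguesCoeff l (l + m)).eval x) := by
  have hs : √(1 - x ^ 2) ^ 2 = 1 - x ^ 2 := Real.sq_sqrt (by nlinarith [hx.1, hx.2])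
  have h1 : ((-1 : ℝ) ^ m) * (-1) ^ m = 1 := by rw [← mul_pow]; norm_num
  rw [polarFactor, eval_rodriguesCoeff_reflect hm, mul_pow, ← pow_mul, mul_comm m 2, pow_mul, hs]
  linear_combination (-(1 - x ^ 2) ^ m * (rodriguesCoeff l (l + m)).eval x ^ 2) * h1

theorem integral_polarFactor_sq {l m : ℕ} (hm : m ≤ l) :
    ((l - m).factorial * (l + m).factorial * (2 * l + 1) : ℝ) *
      ∫ x in (-1 : ℝ)..1, polarFactor l m x ^ 2 = 2 ^ (2 * l + 1) * (l.factorial : ℝ) ^ 2 := by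
  have h1 : ∫ x in (-1 : ℝ)..1, polarFactor l m x ^ 2 = ∫ x in (-1 : ℝ)..1,
      (-1) ^ m * ((rodriguesCoeff l (l - m)).eval x * (rodriguesCoeff l (l + m)).eval x) := by
    refine intervalIntegral.integral_congr fun x hx => ?_
    rw [uIcc_of_le (by norm_num)] at hx
    exact polarFactor_sq hm hx
  have h2 := integral_iterate_derivative_rodrigues_mul (Nat.sub_le l m)
    (derivative^[l + m] ((X ^ 2 - 1 : ℝ[X]) ^ l))
  have h3 : ∀ x : ℝ, ((X ^ 2 - 1 : ℝ[X]) ^ l).eval x *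
      (derivative^[2 * l] ((X ^ 2 - 1 : ℝ[X]) ^ l)).eval x =
      ((-1) ^ l * (2 * l).factorial) * (1 - x ^ 2) ^ l := by
    intro x
    rw [eval_iterate_derivative_rodrigues, eval_rodriguesCoeff, trinomialCoeff_two_mul]
    simp only [eval_pow, eval_sub, eval_X, eval_one, one_pow, mul_one]
    rw [show x ^ 2 - 1 = -1 * (1 - x ^ 2) by ring, mul_pow]
    ring
  rw [← Function.iterate_add_apply, show l - m + (l + m) = 2 * l by omega] at h2
  simp_rw [h3, eval_iterate_derivative_rodrigues] at h2
  rw [intervalIntegral.integral_const_mul] at h2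
  have h4 : ∀ x : ℝ, ((l - m).factorial * (rodriguesCoeff l (l - m)).eval x) *
      ((l + m).factorial * (rodriguesCoeff l (l + m)).eval x) =
      ((l - m).factorial * (l + m).factorial : ℝ) *
      ((rodriguesCoeff l (l - m)).eval x * (rodriguesCoeff l (l + m)).eval x) := fun x => by ring
  simp_rw [h4] at h2
  rw [intervalIntegral.integral_const_mul] at h2
  rw [h1, intervalIntegral.integral_const_mul]
  have h5 := integral_one_sub_sq_pow l
  rw [Nat.factorial_succ] at h5
  push_cast at h5
  have hsign : (-1 : ℝ) ^ m * ((-1) ^ (l - m) * (-1) ^ l) = 1 := by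
    rw [← mul_assoc, ← pow_add, Nat.add_sub_cancel' hm, ← mul_pow]
    norm_num
  linear_combination (2 * l + 1) * (-1) ^ m * h2 + h5 +
    (2 * l + 1) * ((2 * l).factorial : ℝ) * (∫ x in (-1 : ℝ)..1, (1 - x ^ 2) ^ l) * hsign

end

/-- The azimuthal factor of the real spherical harmonic of order `k`. -/
noncomputable def azimuthalFactor (k : ℤ) (φ : ℝ) : ℝ :=
  if 0 < k then Real.cos ((k.natAbs : ℝ) * φ)
  else if k = 0 then 1 / √2
  else Real.sin ((k.natAbs : ℝ) * φ)

theorem continuous_azimuthalFactor (k : ℤ) : Continuous (azimuthalFactor k) := by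
  unfold azimuthalFactor
  split_ifs <;> fun_prop

theorem integral_cos_int_mul (n : ℤ) :
    ∫ φ in (0 : ℝ)..(2 * π), Real.cos (n * φ) = if n = 0 then 2 * π else 0 := by
  split_ifs with h
  · simp [h]
  · rw [intervalIntegral.integral_comp_mul_left (fun x => Real.cos x) (by exact_mod_cast h)]
    have := Real.sin_int_mul_pi (n * 2)
    push_cast at this
    rw [mul_assoc] at this
    simp [this]

theorem integral_sin_int_mul (n : ℤ) : ∫ φ in (0 : ℝ)..(2 * π), Real.sin (n * φ) = 0 := by
  by_cases h : n = 0
  · simp [h]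
  · rw [intervalIntegral.integral_comp_mul_left (fun x => Real.sin x) (by exact_mod_cast h)]
    simp [Real.cos_int_mul_two_pi]

theorem integral_azimuthalFactor_mul (j k : ℤ) :
    ∫ φ in (0 : ℝ)..(2 * π), azimuthalFactor j φ * azimuthalFactor k φ =
      if j = k then π else 0 := by
  have hcc : ∀ m n : ℕ, ∫ φ in (0 : ℝ)..(2 * π), Real.cos (m * φ) * Real.cos (n * φ) =
      ((if (m : ℤ) - n = 0 then 2 * π else 0) + if (m : ℤ) + n = 0 then 2 * π else 0) / 2 := by
    intro m n
    rw [← integral_cos_int_mul, ← integral_cos_int_mul, ← intervalIntegral.integral_add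
      (Continuous.intervalIntegrable (by fun_prop) _ _)
      (Continuous.intervalIntegrable (by fun_prop) _ _), ← intervalIntegral.integral_div]
    congr 1
    funext φ
    push_cast
    rw [sub_mul, add_mul, Real.cos_sub, Real.cos_add]
    ring
  have hss : ∀ m n : ℕ, ∫ φ in (0 : ℝ)..(2 * π), Real.sin (m * φ) * Real.sin (n * φ) =
      ((if (m : ℤ) - n = 0 then 2 * π else 0) - if (m : ℤ) + n = 0 then 2 * π else 0) / 2 := by
    intro m n
    rw [← integral_cos_int_mul, ← integral_cos_int_mul, ← intervalIntegral.integral_sub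
      (Continuous.intervalIntegrable (by fun_prop) _ _)
      (Continuous.intervalIntegrable (by fun_prop) _ _), ← intervalIntegral.integral_div]
    congr 1
    funext φ
    push_cast
    rw [sub_mul, add_mul, Real.cos_sub, Real.cos_add]
    ring
  have hsc : ∀ m n : ℕ, ∫ φ in (0 : ℝ)..(2 * π), Real.sin (m * φ) * Real.cos (n * φ) = 0 := by
    intro m n
    have h : ∫ φ in (0 : ℝ)..(2 * π), (Real.sin (((m + n : ℤ) : ℝ) * φ) +
        Real.sin (((m - n : ℤ) : ℝ) * φ)) / 2 = 0 := by
      rw [intervalIntegral.integral_div, intervalIntegral.integral_add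
        (Continuous.intervalIntegrable (by fun_prop) _ _)
        (Continuous.intervalIntegrable (by fun_prop) _ _), integral_sin_int_mul,
        integral_sin_int_mul]
      simp
    rw [← h]
    congr 1
    funext φ
    push_cast
    rw [sub_mul, add_mul, Real.sin_sub, Real.sin_add]
    ring
  have hcs : ∀ m n : ℕ, ∫ φ in (0 : ℝ)..(2 * π), Real.cos (m * φ) * Real.sin (n * φ) = 0 := by
    intro m n
    simp_rw [mul_comm (Real.cos _)]
    exact hsc n m
  have hc : ∀ n : ℕ, ∫ φ in (0 : ℝ)..(2 * π), Real.cos (n * φ) = if (n : ℤ) = 0 then 2 * π else 0 :=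
    fun n => by exact_mod_cast integral_cos_int_mul n
  have hs : ∀ n : ℕ, ∫ φ in (0 : ℝ)..(2 * π), Real.sin (n * φ) = 0 :=
    fun n => by exact_mod_cast integral_sin_int_mul n
  have h2 : (√2)⁻¹ * (√2)⁻¹ = (2 : ℝ)⁻¹ := by rw [← mul_inv, Real.mul_self_sqrt zero_le_two]
  unfold azimuthalFactor
  rcases lt_trichotomy 0 j with hj | hj | hj <;> rcases lt_trichotomy 0 k with hk | hk | hk
  · simp only [if_pos hj, if_pos hk, hcc]
    rw [if_neg (c := (j.natAbs : ℤ) + k.natAbs = 0) (by omega)]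
    split_ifs <;> first | omega | ring
  · subst hk
    simp only [if_pos hj, lt_irrefl, if_false, if_true, intervalIntegral.integral_mul_const, hc]
    rw [if_neg (by omega), if_neg (by omega), zero_mul]
  · simp only [if_pos hj, if_neg hk.not_gt, if_neg hk.ne, hcs]
    rw [if_neg (by omega)]
  · subst hj
    simp only [if_pos hk, lt_irrefl, if_false, if_true, intervalIntegral.integral_const_mul, hc]
    rw [if_neg (by omega), if_neg (by omega), mul_zero]
  · subst hj hk
    simp [h2]
    ring
  · subst hj
    simp only [if_neg hk.not_gt, if_neg hk.ne, lt_irrefl, if_false, if_true,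
      intervalIntegral.integral_const_mul, hs]
    rw [if_neg (by omega), mul_zero]
  · simp only [if_pos hk, if_neg hj.not_gt, if_neg hj.ne, hsc]
    rw [if_neg (by omega)]
  · subst hk
    simp only [if_neg hj.not_gt, if_neg hj.ne, lt_irrefl, if_false, if_true,
      intervalIntegral.integral_mul_const, hs]
    rw [zero_mul]
  · simp only [if_neg hk.not_gt, if_neg hk.ne, if_neg hj.not_gt, if_neg hj.ne, hss]
    rw [if_neg (c := (j.natAbs : ℤ) + k.natAbs = 0) (by omega)]
    split_ifs <;> first | omega | ring

/-- The constant relating `sphHarm` to the product of its polar and azimuthal factors. -/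
noncomputable def sphHarmNorm (l m : ℕ) : ℝ :=
  (-1) ^ m * √((2 * (l : ℝ) + 1) / (2 * π) * (((l - m).factorial : ℝ) / ((l + m).factorial : ℝ))) *
    ((l + m).factorial / (2 ^ l * l.factorial))

theorem sphHarmNorm_ne_zero (l m : ℕ) : sphHarmNorm l m ≠ 0 := by
  have h : 0 < √((2 * (l : ℝ) + 1) / (2 * π) *
      (((l - m).factorial : ℝ) / ((l + m).factorial : ℝ))) := Real.sqrt_pos.2 (by positivity)
  have h' : (0 : ℝ) < (l + m).factorial / (2 ^ l * l.factorial) := by positivity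
  exact mul_ne_zero (mul_ne_zero (pow_ne_zero _ (by norm_num)) h.ne') h'.ne'

theorem sphHarmNorm_sq_mul_integral {l m : ℕ} (hm : m ≤ l) :
    sphHarmNorm l m ^ 2 * π * ∫ x in (-1 : ℝ)..1, polarFactor l m x ^ 2 = 1 := by
  have hI := integral_polarFactor_sq hm
  have hpos : (0 : ℝ) < (l - m).factorial * (l + m).factorial * (2 * l + 1) := by positivity
  rw [mul_comm, ← eq_div_iff hpos.ne'] at hI
  have hpi := Real.pi_pos
  have hf1 : (0 : ℝ) < (l - m).factorial := by positivity
  have hf2 : (0 : ℝ) < (l + m).factorial := by positivity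
  have hf3 : (0 : ℝ) < l.factorial := by positivity
  have hs : ((-1 : ℝ) ^ m) ^ 2 = 1 := by rw [← pow_mul, mul_comm, pow_mul]; norm_num
  rw [hI, sphHarmNorm, mul_pow, mul_pow, hs, Real.sq_sqrt (by positivity)]
  field_simp
  ring

theorem sphHarm_eq (l : ℕ) (k : ℤ) {x : ℝ} (hx : x ∈ Icc (-1 : ℝ) 1) (φ : ℝ) :
    sphHarm l k x φ =
      sphHarmNorm l k.natAbs * polarFactor l k.natAbs x * azimuthalFactor k φ := by
  rw [sphHarm, assocLegendre_eq l _ hx, sphHarmNorm, azimuthalFactor]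
  ring

/-- The spherical harmonics as complex functions on the domain of the spherical coordinates. -/
noncomputable def sphHarmCoord (l : ℕ) (k : ℤ) (p : Icc (-1 : ℝ) 1 × ℝ) : ℂ :=
  sphHarm l k p.1 p.2

theorem polarFactor_mul_cos_mem_span {l m : ℕ} (hm : m ≤ l) :
    (fun p : Icc (-1 : ℝ) 1 × ℝ => ((polarFactor l m p.1 * Real.cos (m * p.2) : ℝ) : ℂ)) ∈
      Submodule.span ℂ (sphHarmCoord l '' (Finset.Icc (-(l : ℤ)) l : Finset ℤ)) := by
  have hmem : sphHarmCoord l m ∈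
      Submodule.span ℂ (sphHarmCoord l '' (Finset.Icc (-(l : ℤ)) l : Finset ℤ)) :=
    Submodule.subset_span ⟨m, by simp; omega, rfl⟩
  have hN : (sphHarmNorm l m : ℂ) ≠ 0 := by exact_mod_cast sphHarmNorm_ne_zero l m
  rcases Nat.eq_zero_or_pos m with rfl | h0
  · convert Submodule.smul_mem _ (((√2 : ℝ) : ℂ) * (sphHarmNorm l 0 : ℂ)⁻¹) hmem using 1
    funext p
    have h2 : ((√2 : ℝ) : ℂ) ≠ 0 := by exact_mod_cast (Real.sqrt_pos.2 two_pos).ne'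
    simp only [Pi.smul_apply, smul_eq_mul, sphHarmCoord, sphHarm_eq l _ p.1.2, azimuthalFactor]
    simp
    field_simp
  · convert Submodule.smul_mem _ ((sphHarmNorm l m : ℂ)⁻¹) hmem using 1
    funext p
    simp only [Pi.smul_apply, smul_eq_mul, sphHarmCoord, sphHarm_eq l _ p.1.2, azimuthalFactor,
      Int.natAbs_natCast]
    rw [if_pos (by omega)]
    push_cast
    field_simp

theorem polarFactor_mul_sin_mem_span {l m : ℕ} (hm : m ≤ l) :
    (fun p : Icc (-1 : ℝ) 1 × ℝ => ((polarFactor l m p.1 * Real.sin (m * p.2) : ℝ) : ℂ)) ∈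
      Submodule.span ℂ (sphHarmCoord l '' (Finset.Icc (-(l : ℤ)) l : Finset ℤ)) := by
  rcases Nat.eq_zero_or_pos m with rfl | h0
  · convert Submodule.zero_mem _ using 1
    funext p
    simp
  have hmem : sphHarmCoord l (-m) ∈
      Submodule.span ℂ (sphHarmCoord l '' (Finset.Icc (-(l : ℤ)) l : Finset ℤ)) :=
    Submodule.subset_span ⟨-m, by simp; omega, rfl⟩
  have hN : (sphHarmNorm l m : ℂ) ≠ 0 := by exact_mod_cast sphHarmNorm_ne_zero l m
  convert Submodule.smul_mem _ ((sphHarmNorm l m : ℂ)⁻¹) hmem using 1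
  funext p
  simp only [Pi.smul_apply, smul_eq_mul, sphHarmCoord, sphHarm_eq l _ p.1.2, azimuthalFactor,
    Int.natAbs_neg, Int.natAbs_natCast]
  rw [if_neg (by omega), if_neg (by omega)]
  push_cast
  field_simp

theorem isotropicCoeff_sub_dirVec {l m : ℕ} (hm : m ≤ l) {x : ℝ} (hx : x ∈ Icc (-1 : ℝ) 1)
    (φ : ℝ) : isotropicCoeff l (l - m) (dirVec x φ) =
      (-1) ^ m * ((polarFactor l m x : ℂ) *
        (Real.cos (m * φ) - Real.sin (m * φ) * Complex.I)) := by
  rw [isotropicCoeff_sub hm, isotropicCoeff_dirVec hx, ← polarFactor]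
  simp only [map_mul, map_add, Complex.conj_ofReal, Complex.conj_I]
  ring

theorem isotropicCoeff_dirVec_mem_span (l n : ℕ) :
    (fun p : Icc (-1 : ℝ) 1 × ℝ => isotropicCoeff l n (dirVec p.1 p.2)) ∈
      Submodule.span ℂ (sphHarmCoord l '' (Finset.Icc (-(l : ℤ)) l : Finset ℤ)) := by
  rcases lt_or_ge (2 * l) n with hn | hn
  · rw [isotropicCoeff_eq_zero hn]
    exact Submodule.zero_mem _
  rcases le_total l n with h | h
  · obtain ⟨m, rfl⟩ := Nat.exists_eq_add_of_le h
    have hm : m ≤ l := by omega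
    convert Submodule.add_mem _ (polarFactor_mul_cos_mem_span hm)
      (Submodule.smul_mem _ Complex.I (polarFactor_mul_sin_mem_span hm)) using 1
    funext p
    rw [isotropicCoeff_dirVec p.1.2, ← polarFactor]
    simp only [Pi.add_apply, Pi.smul_apply, smul_eq_mul]
    push_cast
    ring
  · obtain ⟨m, hm, rfl⟩ : ∃ m, m ≤ l ∧ n = l - m := ⟨l - n, by omega, by omega⟩
    convert Submodule.smul_mem _ ((-1 : ℂ) ^ m) (Submodule.sub_mem _
      (polarFactor_mul_cos_mem_span hm)
      (Submodule.smul_mem _ Complex.I (polarFactor_mul_sin_mem_span hm))) using 1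
    funext p
    rw [isotropicCoeff_sub_dirVec hm p.1.2]
    simp only [Pi.sub_apply, Pi.smul_apply, smul_eq_mul]
    push_cast
    ring

theorem exists_sphHarm_eq_isotropicCoeff {l : ℕ} {k : ℤ} (hk : |k| ≤ (l : ℤ)) :
    ∃ a b : ℂ, ∀ x ∈ Icc (-1 : ℝ) 1, ∀ φ : ℝ, (sphHarm l k x φ : ℂ) =
      a * isotropicCoeff l (l + k.natAbs) (dirVec x φ) +
        b * isotropicCoeff l (l - k.natAbs) (dirVec x φ) := by
  have hm : k.natAbs ≤ l := by rw [Int.abs_eq_natAbs] at hk; omega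
  have hsq : ((-1 : ℂ) ^ k.natAbs) * (-1) ^ k.natAbs = 1 := by rw [← mul_pow]; norm_num
  set N : ℂ := (sphHarmNorm l k.natAbs : ℂ) with hN
  rcases lt_trichotomy 0 k with h | h | h
  · refine ⟨N / 2, N / 2 * (-1) ^ k.natAbs, fun x hx φ => ?_⟩
    rw [isotropicCoeff_sub_dirVec hm hx, isotropicCoeff_dirVec hx, ← polarFactor,
      sphHarm_eq l k hx, azimuthalFactor, if_pos h]
    push_cast
    linear_combination (-(N / 2) * (polarFactor l k.natAbs x) *
      (Complex.cos (k.natAbs * φ) - Complex.sin (k.natAbs * φ) * Complex.I)) * hsq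
  · refine ⟨N * ((1 / √2 : ℝ) : ℂ), 0, fun x hx φ => ?_⟩
    rw [isotropicCoeff_dirVec hx, ← polarFactor, sphHarm_eq l k hx, azimuthalFactor,
      if_neg h.not_lt, if_pos h.symm]
    subst h
    push_cast
    simp [hN]
    ring
  · refine ⟨-Complex.I * N / 2, Complex.I * N / 2 * (-1) ^ k.natAbs, fun x hx φ => ?_⟩
    rw [isotropicCoeff_sub_dirVec hm hx, isotropicCoeff_dirVec hx, ← polarFactor,
      sphHarm_eq l k hx, azimuthalFactor, if_neg h.not_gt, if_neg h.ne]
    push_cast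
    linear_combination (-(Complex.I * N / 2) * (polarFactor l k.natAbs x) *
      (Complex.cos (k.natAbs * φ) - Complex.sin (k.natAbs * φ) * Complex.I)) * hsq +
      N * polarFactor l k.natAbs x * Complex.sin (k.natAbs * φ) * Complex.I_sq

theorem dirVec_arg {w : Fin 3 → ℝ} (hw : w 0 ^ 2 + w 1 ^ 2 + w 2 ^ 2 = 1) :
    dirVec (w 2) (Complex.arg ⟨w 0, w 1⟩) = w := by
  have hn : √(1 - w 2 ^ 2) = ‖(⟨w 0, w 1⟩ : ℂ)‖ := by
    rw [Complex.norm_def, Complex.normSq_mk]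
    congr 1
    linarith
  funext i
  fin_cases i
  · simp [dirVec, hn, Complex.norm_mul_cos_arg]
  · simp [dirVec, hn, Complex.norm_mul_sin_arg]
  · simp [dirVec]

theorem dirVec_sq_add_sq_add_sq {x : ℝ} (hx : x ∈ Icc (-1 : ℝ) 1) (φ : ℝ) :
    dirVec x φ 0 ^ 2 + dirVec x φ 1 ^ 2 + dirVec x φ 2 ^ 2 = 1 := by
  have hs : √(1 - x ^ 2) ^ 2 = 1 - x ^ 2 := Real.sq_sqrt (by nlinarith [hx.1, hx.2])
  simp only [dirVec, Matrix.cons_val_zero, Matrix.cons_val_one, Matrix.cons_val]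
  linear_combination √(1 - x ^ 2) ^ 2 * Real.cos_sq_add_sin_sq φ + hs

theorem mulVec_sq_add_sq_add_sq {R : Matrix (Fin 3) (Fin 3) ℝ} (hR : R.transpose * R = 1)
    (v : Fin 3 → ℝ) : R.mulVec v 0 ^ 2 + R.mulVec v 1 ^ 2 + R.mulVec v 2 ^ 2 =
      v 0 ^ 2 + v 1 ^ 2 + v 2 ^ 2 := by
  have h : R.mulVec v ⬝ᵥ R.mulVec v = v ⬝ᵥ v := by
    rw [Matrix.dotProduct_mulVec, ← Matrix.mulVec_transpose, Matrix.mulVec_mulVec, hR,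
      Matrix.one_mulVec]
  simpa [dotProduct, Fin.sum_univ_three, ← sq] using h

theorem exists_sphHarmVec_mulVec_eq_sum {l : ℕ} {k : ℤ} (hk : |k| ≤ (l : ℤ))
    {R : Matrix (Fin 3) (Fin 3) ℝ} (hR : R ∈ Matrix.orthogonalGroup (Fin 3) ℝ) :
    ∃ c : ℤ → ℝ, ∀ x ∈ Icc (-1 : ℝ) 1, ∀ φ : ℝ,
      sphHarmVec l k (R.mulVec (dirVec x φ)) =
        ∑ j ∈ Finset.Icc (-(l : ℤ)) (l : ℤ), c j * sphHarm l j x φ := by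
  have hR1 : R * R.transpose = 1 := (Matrix.mem_orthogonalGroup_iff (Fin 3) ℝ).1 hR
  have hR2 : R.transpose * R = 1 := (Matrix.mem_orthogonalGroup_iff' (Fin 3) ℝ).1 hR
  obtain ⟨a, b, hab⟩ := exists_sphHarm_eq_isotropicCoeff hk
  set S := Submodule.span ℂ (sphHarmCoord l '' (Finset.Icc (-(l : ℤ)) l : Finset ℤ)) with hS
  have hpull : ∀ f ∈ Submodule.span ℂ (Set.range (isotropicCoeff l)),
      (fun p : Icc (-1 : ℝ) 1 × ℝ => f (dirVec p.1 p.2)) ∈ S := by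
    intro f hf
    have hle : Submodule.span ℂ (Set.range (isotropicCoeff l)) ≤
        S.comap (LinearMap.funLeft ℂ ℂ fun p : Icc (-1 : ℝ) 1 × ℝ => dirVec p.1 p.2) := by
      rw [Submodule.span_le]
      rintro _ ⟨n, rfl⟩
      exact isotropicCoeff_dirVec_mem_span l n
    exact hle hf
  have hmem : (fun p : Icc (-1 : ℝ) 1 × ℝ =>
      (sphHarmVec l k (R.mulVec (dirVec p.1 p.2)) : ℂ)) ∈ S := by
    convert Submodule.add_mem _
      (Submodule.smul_mem _ a (hpull _ (isotropicCoeff_mulVec_mem_span l (l + k.natAbs) hR1)))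
      (Submodule.smul_mem _ b (hpull _ (isotropicCoeff_mulVec_mem_span l (l - k.natAbs) hR1)))
      using 1
    funext p
    have hw := (mulVec_sq_add_sq_add_sq hR2 (dirVec p.1 p.2)).trans
      (dirVec_sq_add_sq_add_sq p.1.2 p.2)
    have := hab (R.mulVec (dirVec p.1 p.2) 2) ⟨by nlinarith, by nlinarith⟩
      (Complex.arg ⟨R.mulVec (dirVec p.1 p.2) 0, R.mulVec (dirVec p.1 p.2) 1⟩)
    rw [dirVec_arg hw] at this
    exact this
  obtain ⟨c, hc⟩ := (Submodule.mem_span_image_finset_iff_exists_fun' ℂ).1 hmem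
  refine ⟨fun j => (c j).re, fun x hx φ => ?_⟩
  have := congrArg Complex.re (congrFun hc (⟨x, hx⟩, φ))
  simp only [Finset.sum_apply, Pi.smul_apply, smul_eq_mul, sphHarmCoord, Complex.re_sum,
    Complex.re_mul_ofReal, Complex.ofReal_re] at this
  exact this.symm

/-- The real spherical harmonics of degree `l` are orthonormal: the coefficients of a combination
are its integrals against them. -/
theorem integral_sum_sphHarm_mul {l : ℕ} {j : ℤ} (hj : j ∈ Finset.Icc (-(l : ℤ)) l) (c : ℤ → ℝ) :
    ∫ x in (-1 : ℝ)..1, ∫ φ in (0 : ℝ)..(2 * π),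
      (∑ i ∈ Finset.Icc (-(l : ℤ)) (l : ℤ), c i * sphHarm l i x φ) * sphHarm l j x φ = c j := by
  have hm : j.natAbs ≤ l := by have := Finset.mem_Icc.1 hj; omega
  have hinner : ∀ x ∈ uIcc (-1 : ℝ) 1, ∫ φ in (0 : ℝ)..(2 * π),
      (∑ i ∈ Finset.Icc (-(l : ℤ)) (l : ℤ), c i * sphHarm l i x φ) * sphHarm l j x φ =
      c j * (sphHarmNorm l j.natAbs ^ 2 * π) * polarFactor l j.natAbs x ^ 2 := by
    intro x hx
    rw [uIcc_of_le (by norm_num)] at hx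
    have e : ∀ φ : ℝ,
        (∑ i ∈ Finset.Icc (-(l : ℤ)) (l : ℤ), c i * sphHarm l i x φ) * sphHarm l j x φ =
        ∑ i ∈ Finset.Icc (-(l : ℤ)) (l : ℤ),
          c i * (sphHarmNorm l i.natAbs * polarFactor l i.natAbs x) *
            (sphHarmNorm l j.natAbs * polarFactor l j.natAbs x) *
            (azimuthalFactor i φ * azimuthalFactor j φ) := by
      intro φ
      rw [Finset.sum_mul]
      refine Finset.sum_congr rfl fun i _ => ?_
      rw [sphHarm_eq l i hx, sphHarm_eq l j hx]
      ring
    simp_rw [e]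
    have hcont : ∀ i, Continuous (azimuthalFactor i) := continuous_azimuthalFactor
    rw [intervalIntegral.integral_finsetSum fun i _ =>
      Continuous.intervalIntegrable (by fun_prop) _ _]
    simp_rw [intervalIntegral.integral_const_mul, integral_azimuthalFactor_mul, mul_ite, mul_zero]
    rw [Finset.sum_ite_eq', if_pos hj]
    ring
  rw [intervalIntegral.integral_congr hinner, intervalIntegral.integral_const_mul, mul_assoc,
    sphHarmNorm_sq_mul_integral hm, mul_one]

/-- for every rotation `R ∈ SO(3)` the rotated real spherical harmonic
`Ω ↦ Y_l^k(RΩ)` lies in the linear span of the real spherical harmonics of degree `l`;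
moreover `Y_l^k(RΩ) = ∑_{k'=-l}^{l} D^l_{k,k'} Y_l^{k'}(Ω)` with
`D^l_{k,k'} = ∫_{S²} Y_l^k(RΩ') Y_l^{k'}(Ω') dΩ'`. -/
theorem sphHarm_rotation_invariance (l : ℕ) (k : ℤ) (hk : |k| ≤ (l : ℤ))
    (R : Matrix (Fin 3) (Fin 3) ℝ) (hR : R ∈ Matrix.specialOrthogonalGroup (Fin 3) ℝ) :
    (∃ c : ℤ → ℝ, ∀ μ ∈ Set.Icc (-1 : ℝ) 1, ∀ φ : ℝ,
      sphHarmVec l k (R.mulVec (dirVec μ φ)) =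
        ∑ k' ∈ Finset.Icc (-(l : ℤ)) (l : ℤ), c k' * sphHarm l k' μ φ) ∧
    (∀ μ ∈ Set.Icc (-1 : ℝ) 1, ∀ φ : ℝ,
      sphHarmVec l k (R.mulVec (dirVec μ φ)) =
        ∑ k' ∈ Finset.Icc (-(l : ℤ)) (l : ℤ),
          (∫ μ' in (-1 : ℝ)..1, ∫ φ' in (0 : ℝ)..(2 * Real.pi),
            sphHarmVec l k (R.mulVec (dirVec μ' φ')) * sphHarm l k' μ' φ') *
          sphHarm l k' μ φ) := by
  obtain ⟨c, hc⟩ := exists_sphHarmVec_mulVec_eq_sum hk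
    (Matrix.mem_specialOrthogonalGroup_iff.1 hR).1
  refine ⟨⟨c, hc⟩, fun μ hμ φ => ?_⟩
  rw [hc μ hμ φ]
  refine Finset.sum_congr rfl fun j hj => ?_
  congr 1
  rw [← integral_sum_sphHarm_mul hj c]
  refine intervalIntegral.integral_congr fun x hx => ?_
  rw [uIcc_of_le (by norm_num)] at hx
  refine intervalIntegral.integral_congr fun ψ _ => ?_
  simp only [hc x hx ψ]
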